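/- arXiv:math/0404160 — 3 statements merged into one kernel-verified Lean document; each statement's English description precedes it below -/
import Mathlib

section
/- Let c > 0 and H > 0. There exist γ > 0 and α ∈ (0,1), depending only on c and H, with the following property: if (a_j)_{j≥0} is a sequence of real numbers with a_j ≥ −H for all j and limsup_{n→∞} (1/n)∑_{j=0}^{n−1} a_j ≤ −c, then for every sufficiently large integer N there exist at least γ·N integers n with 1 ≤ n ≤ N that are α-hyperbolic times for (a_j). -/
open scoped Classical

/-- Given `α ∈ (0,1)` and a sequence `(a j)` of reals, `n ≥ 1` is an `α`-hyperbolic time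
for `(a j)` if `∑_{j=n−k}^{n−1} a j ≤ k · log α` for every `k = 1, …, n`. -/
def IsHyperbolicTime (α : ℝ) (a : ℕ → ℝ) (n : ℕ) : Prop :=
  1 ≤ n ∧ ∀ k, 1 ≤ k → k ≤ n → ∑ j ∈ Finset.Ico (n - k) n, a j ≤ (k : ℝ) * Real.log α

/-- The running minimum of partial sums whose increments are at least `-H` drops only at
hyperbolic times, so every partial sum is at least `-H` times the number of these. -/
lemma neg_mul_card_isHyperbolicTime_le_sum {H d : ℝ} (hH : 0 ≤ H) (hd : 0 ≤ d)
    {a : ℕ → ℝ} (ha : ∀ j, -H ≤ a j) (N : ℕ) :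
    ∀ m ≤ N, -H * (((Finset.Icc 1 N).filter
        fun n => IsHyperbolicTime (Real.exp (-d)) a n).card : ℝ) ≤
      ∑ j ∈ Finset.range m, (a j + d) := by
  induction N with
  | zero =>
    intro m hm
    obtain rfl : m = 0 := by omega
    simp
  | succ N ih =>
    have hIcc : Finset.Icc 1 (N + 1) = insert (N + 1) (Finset.Icc 1 N) := by
      ext x
      simp only [Finset.mem_Icc, Finset.mem_insert]
      omega
    have hnot : N + 1 ∉ (Finset.Icc 1 N).filter
        fun n => IsHyperbolicTime (Real.exp (-d)) a n := by simp
    intro m hm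
    rw [hIcc, Finset.filter_insert]
    by_cases hyp : IsHyperbolicTime (Real.exp (-d)) a (N + 1)
    · rw [if_pos hyp, Finset.card_insert_of_notMem hnot]
      push_cast
      rcases Nat.lt_or_ge N m with h | h
      · obtain rfl : m = N + 1 := by omega
        rw [Finset.sum_range_succ]
        linarith [ih N le_rfl, ha N]
      · linarith [ih m h]
    · rw [if_neg hyp]
      rcases Nat.lt_or_ge N m with h | h
      · obtain rfl : m = N + 1 := by omega
        simp only [IsHyperbolicTime, not_and, not_forall, not_le, Real.log_exp] at hyp
        obtain ⟨k, hk1, hk2, hk⟩ := hyp (by omega)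
        have hsplit := Finset.sum_range_add_sum_Ico (fun j => a j + d)
          (Nat.sub_le (N + 1) k)
        have hIco : ∑ j ∈ Finset.Ico (N + 1 - k) (N + 1), (a j + d) =
            ∑ j ∈ Finset.Ico (N + 1 - k) (N + 1), a j + k * d := by
          rw [Finset.sum_add_distrib, Finset.sum_const, Nat.card_Ico,
            Nat.sub_sub_self hk2, nsmul_eq_mul]
        linarith [ih (N + 1 - k) (by omega)]
      · exact ih m h

/-- A negative upper bound on a real `limsup` forces eventual bounds, as the `limsup` of a
sequence that is not eventually bounded above is zero by convention. -/
lemma eventually_le_of_limsup_lt_of_neg {u : ℕ → ℝ} {b : ℝ} (hb : b ≤ 0)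
    (h : Filter.limsup u Filter.atTop < b) : ∀ᶠ n in Filter.atTop, u n ≤ b := by
  rw [Filter.limsup_eq] at h
  have hne : {x : ℝ | ∀ᶠ n in Filter.atTop, u n ≤ x}.Nonempty := by
    by_contra hempty
    rw [Set.not_nonempty_iff_eq_empty] at hempty
    rw [hempty, Real.sInf_empty] at h
    linarith
  obtain ⟨x, hx, hxb⟩ := exists_lt_of_csInf_lt hne h
  exact hx.mono fun n hn => hn.trans hxb.le

/-- **Existence of a positive density of hyperbolic times (Pliss).** Let `c > 0` and `H > 0`.
There exist `γ > 0` and `α ∈ (0,1)`, depending only on `c` and `H`, such that: for every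
sequence `(a j)` with `a j ≥ −H` for all `j` and
`limsup (1/n) ∑_{j=0}^{n−1} a j ≤ −c`, for every sufficiently large `N` there are at least
`γ·N` integers `n ∈ [1, N]` which are `α`-hyperbolic times for `(a j)`. -/
theorem positive_density_of_hyperbolic_times (c H : ℝ) (hc : 0 < c) (hH : 0 < H) :
    ∃ γ > (0 : ℝ), ∃ α : ℝ, 0 < α ∧ α < 1 ∧
      ∀ a : ℕ → ℝ, (∀ j, -H ≤ a j) →
        Filter.limsup (fun n : ℕ => (n : ℝ)⁻¹ * ∑ j ∈ Finset.range n, a j)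
            Filter.atTop ≤ -c →
        ∃ N₀ : ℕ, ∀ N ≥ N₀,
          γ * (N : ℝ) ≤
            (((Finset.Icc 1 N).filter fun n => IsHyperbolicTime α a n).card : ℝ) := by
  refine ⟨c / (4 * H), by positivity, Real.exp (-(c / 4)), Real.exp_pos _,
    Real.exp_lt_one_iff.mpr (by linarith), fun a ha hlim => ?_⟩
  obtain ⟨N₀, hN₀⟩ := Filter.eventually_atTop.1
    (eventually_le_of_limsup_lt_of_neg (b := -(c / 2)) (by linarith) (hlim.trans_lt (by linarith)))
  refine ⟨max N₀ 1, fun N hN => ?_⟩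
  have hNpos : (0 : ℝ) < N := by
    exact_mod_cast (le_max_right N₀ 1).trans hN
  have hsum := hN₀ N ((le_max_left _ _).trans hN)
  rw [inv_mul_le_iff₀ hNpos] at hsum
  have hmin := neg_mul_card_isHyperbolicTime_le_sum hH.le (d := c / 4) (by linarith) ha N N le_rfl
  rw [Finset.sum_add_distrib, Finset.sum_const, Finset.card_range, nsmul_eq_mul] at hmin
  rw [div_mul_eq_mul_div, div_le_iff₀ (by positivity)]
  linarith
end

section
/- Let θ be a Borel probability measure on T and μ a Borel probability measure on M. Define the basin B(μ) as the set of points x ∈ M such that for θ^ℕ-almost every t ∈ T^ℕ one has (1/n)∑_{j=0}^{n−1} φ(f^j_t x) → ∫ φ dμ as n → ∞, for every continuous φ : M → ℝ. If η is a Borel probability measure on M whose topological support is contained in B(μ), then for θ^ℕ-almost every t ∈ T^ℕ the measures (1/n)∑_{j=0}^{n−1} (f^j_t)_* η converge to μ in the weak* topology as n → ∞. -/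
open MeasureTheory Filter Topology

/-- The topological support of a measure: the set of points all of whose open
neighborhoods have positive measure. -/
def measureSupport {X : Type*} [TopologicalSpace X] [MeasurableSpace X]
    (ν : Measure X) : Set X :=
  {x | ∀ U : Set X, IsOpen U → x ∈ U → 0 < ν U}

/-- `θN` is the countable product measure `θ^ℕ` on `T^ℕ`: it is a probability measure
whose value on every finite-dimensional cylinder is the corresponding product. (This
characterizes `θ^ℕ` uniquely.) -/
def IsProductMeasure {T : Type*} [MeasurableSpace T]
    (θ : Measure T) (θN : Measure (ℕ → T)) : Prop :=
  IsProbabilityMeasure θN ∧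
    ∀ (s : Finset ℕ) (f : ℕ → Set T), (∀ i, MeasurableSet (f i)) →
      θN {t | ∀ i ∈ s, t i ∈ f i} = ∏ i ∈ s, θ (f i)

/-- The random iterates `f^n_t = f_{t_n} ∘ ⋯ ∘ f_{t_1}`, with `t 0, t 1, …` playing the
roles of `t₁, t₂, …`, and `f⁰_t = id`. -/
def iterComp {T M : Type*} [TopologicalSpace M]
    (Φ : T → C(M, M)) (t : ℕ → T) : ℕ → M → M
  | 0 => id
  | n + 1 => fun x => Φ (t n) (iterComp Φ t n x)

/-- The basin `B(μ)`: points `x` such that for `θ^ℕ`-a.e. `t` the time averages of every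
continuous function along the random orbit of `x` converge to the space average. -/
def basin {T M : Type*} [MeasurableSpace T] [TopologicalSpace M] [MeasurableSpace M]
    (Φ : T → C(M, M)) (θN : Measure (ℕ → T)) (μ : Measure M) : Set M :=
  {x | ∀ᵐ t ∂θN, ∀ φ : C(M, ℝ),
    Tendsto (fun n : ℕ => (n : ℝ)⁻¹ * ∑ j ∈ Finset.range n, φ (iterComp Φ t j x))
      atTop (𝓝 (∫ y, φ y ∂μ))}

/-- Points of the topological support have full measure in a hereditarily Lindelöf space. -/
lemma ae_mem_measureSupport {X : Type*} [TopologicalSpace X] [HereditarilyLindelofSpace X]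
    [MeasurableSpace X] (ν : Measure X) : ∀ᵐ x ∂ν, x ∈ measureSupport ν := by
  filter_upwards [Measure.support_mem_ae (μ := ν)] with x hx U hU hxU
  exact (Measure.mem_support_iff_forall x).1 hx U (hU.mem_nhds hxU)

lemma continuous_iterComp {T M : Type*} [TopologicalSpace M] (Φ : T → C(M, M)) (t : ℕ → T)
    (n : ℕ) : Continuous (iterComp Φ t n) := by
  induction n with
  | zero => exact continuous_id
  | succ n ih => exact (Φ (t n)).continuous.comp ih

/-- The random iterates are jointly measurable in the noise and the initial point, for the
product σ-algebra on the noise space. -/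
lemma measurable_uncurry_iterComp {T M : Type*} [TopologicalSpace T] [MeasurableSpace T]
    [OpensMeasurableSpace T] [MetricSpace M] [SecondCountableTopology M] [MeasurableSpace M]
    [BorelSpace M] (Φ : T → C(M, M)) (hΦ : Continuous Φ) (n : ℕ) :
    Measurable fun p : (ℕ → T) × M => iterComp Φ p.1 n p.2 := by
  induction n with
  | zero => exact measurable_snd
  | succ n ih =>
    have hev : Measurable (Function.uncurry fun (x : M) (s : T) => Φ s x) :=
      measurable_uncurry_of_continuous_of_measurable (fun s => (Φ s).continuous)
        fun x => ((continuous_eval_const x).comp hΦ).measurable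
    exact hev.comp (ih.prodMk ((measurable_pi_apply n).comp measurable_fst))

/-- Integration against a probability measure is `1`-Lipschitz on continuous functions. -/
lemma dist_integral_continuousMap_le {M : Type*} [TopologicalSpace M] [CompactSpace M]
    [MeasurableSpace M] [OpensMeasurableSpace M] (ν : Measure M) [IsProbabilityMeasure ν]
    (φ ψ : C(M, ℝ)) : dist (∫ x, φ x ∂ν) (∫ x, ψ x ∂ν) ≤ dist φ ψ := by
  have hint (χ : C(M, ℝ)) : Integrable χ ν :=
    χ.continuous.integrable_of_hasCompactSupport (HasCompactSupport.of_compactSpace χ)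
  rw [dist_eq_norm, ← integral_sub (hint φ) (hint ψ)]
  simpa using norm_integral_le_of_norm_le_const (μ := ν) (f := fun x => φ x - ψ x)
    (.of_forall fun x => (dist_eq_norm (φ x) (ψ x)).symm.trans_le
      (ContinuousMap.dist_apply_le_dist x))

lemma abs_inv_mul_sum_range_le {a : ℕ → ℝ} {C : ℝ} (hC : 0 ≤ C) (ha : ∀ j, |a j| ≤ C) (n : ℕ) :
    |(n : ℝ)⁻¹ * ∑ j ∈ Finset.range n, a j| ≤ C := by
  have hsum : |∑ j ∈ Finset.range n, a j| ≤ n * C :=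
    (Finset.abs_sum_le_sum_abs _ _).trans
      ((Finset.sum_le_sum fun j _ => ha j).trans_eq (by simp))
  rw [abs_mul, abs_of_nonneg (by positivity), inv_mul_eq_div]
  exact div_le_of_le_mul₀ (by positivity) hC (by rwa [mul_comm])

/-- For averages of integrals against probability measures, convergence on a dense set of
continuous functions implies convergence on all of them. -/
lemma tendsto_average_integral_of_dense {M : Type*} [TopologicalSpace M] [CompactSpace M]
    [MeasurableSpace M] [OpensMeasurableSpace M] (ν : ℕ → Measure M)
    [∀ j, IsProbabilityMeasure (ν j)] (μ : Measure M) [IsProbabilityMeasure μ]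
    {S : Set C(M, ℝ)} (hS : Dense S)
    (h : ∀ φ ∈ S, Tendsto (fun n : ℕ => (n : ℝ)⁻¹ * ∑ j ∈ Finset.range n, ∫ x, φ x ∂(ν j))
      atTop (𝓝 (∫ y, φ y ∂μ))) (φ : C(M, ℝ)) :
    Tendsto (fun n : ℕ => (n : ℝ)⁻¹ * ∑ j ∈ Finset.range n, ∫ x, φ x ∂(ν j))
      atTop (𝓝 (∫ y, φ y ∂μ)) := by
  have hlip (n : ℕ) : LipschitzWith 1 fun φ : C(M, ℝ) =>
      (n : ℝ)⁻¹ * ∑ j ∈ Finset.range n, ∫ x, φ x ∂(ν j) := by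
    refine LipschitzWith.of_dist_le_mul fun φ ψ => ?_
    rw [NNReal.coe_one, one_mul, Real.dist_eq, ← mul_sub, ← Finset.sum_sub_distrib]
    exact abs_inv_mul_sum_range_le dist_nonneg
      (fun j => dist_integral_continuousMap_le (ν j) φ ψ) n
  have hlim : LipschitzWith 1 fun φ : C(M, ℝ) => ∫ y, φ y ∂μ :=
    LipschitzWith.of_dist_le_mul fun φ ψ => by
      simpa using dist_integral_continuousMap_le μ φ ψ
  have hclosed := (LipschitzWith.uniformEquicontinuous _ 1 hlip).equicontinuous
    |>.isClosed_setOfPred_tendsto (l := atTop) hlim.continuous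
  exact hclosed.closure_subset_iff.2 h (hS φ)

/-- If the orbit averages of `φ` converge to `c` from almost every initial point, then so do
the averages of the integrals of `φ` against the pushforward measures. -/
lemma tendsto_average_integral_map {M : Type*} [TopologicalSpace M] [CompactSpace M]
    [MeasurableSpace M] [BorelSpace M] (η : Measure M) [IsProbabilityMeasure η]
    {g : ℕ → M → M} (hg : ∀ j, Continuous (g j)) (φ : C(M, ℝ)) {c : ℝ}
    (h : ∀ᵐ x ∂η, Tendsto (fun n : ℕ => (n : ℝ)⁻¹ * ∑ j ∈ Finset.range n, φ (g j x))
      atTop (𝓝 c)) :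
    Tendsto (fun n : ℕ => (n : ℝ)⁻¹ * ∑ j ∈ Finset.range n, ∫ x, φ x ∂(Measure.map (g j) η))
      atTop (𝓝 c) := by
  have hcont (j : ℕ) : Continuous fun x => φ (g j x) := φ.continuous.comp (hg j)
  have hint (j : ℕ) : Integrable (fun x => φ (g j x)) η :=
    (hcont j).integrable_of_hasCompactSupport (HasCompactSupport.of_compactSpace _)
  have hconv : Tendsto
      (fun n : ℕ => ∫ x, (n : ℝ)⁻¹ * ∑ j ∈ Finset.range n, φ (g j x) ∂η)
      atTop (𝓝 (∫ _, c ∂η)) :=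
    tendsto_integral_of_dominated_convergence (fun _ => ‖φ‖)
      (fun n => ((integrable_finsetSum _ fun j _ => hint j).const_mul _).aestronglyMeasurable)
      (integrable_const _)
      (fun n => .of_forall fun x =>
        abs_inv_mul_sum_range_le (norm_nonneg φ) (fun j => φ.norm_coe_le_norm (g j x)) n) h
  rw [integral_const, probReal_univ, one_smul] at hconv
  refine hconv.congr fun n => ?_
  rw [integral_const_mul, integral_finsetSum _ fun j _ => hint j]
  congr! 2 with j
  exact (integral_map (hg j).aemeasurable (φ.continuous.stronglyMeasurable_of_hasCompactSupport
    (HasCompactSupport.of_compactSpace _)).aestronglyMeasurable).symm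

/-- If `η` is a Borel probability measure whose topological support is contained in the
basin `B(μ)`, then for `θ^ℕ`-a.e. `t` the averaged pushforwards
`(1/n) ∑_{j=0}^{n−1} (f^j_t)_* η` converge to `μ` in the weak* topology. -/
theorem average_pushforward_converges_on_basin
    {T M : Type*} [MetricSpace T] [MeasurableSpace T] [BorelSpace T]
    [MetricSpace M] [CompactSpace M] [MeasurableSpace M] [BorelSpace M]
    (Φ : T → C(M, M)) (hΦ : Continuous Φ)
    (θ : Measure T) [IsProbabilityMeasure θ]
    (θN : Measure (ℕ → T)) (hθN : IsProductMeasure θ θN)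
    (μ : Measure M) [IsProbabilityMeasure μ]
    (η : Measure M) [IsProbabilityMeasure η]
    (hη : measureSupport η ⊆ basin Φ θN μ) :
    ∀ᵐ t ∂θN, ∀ φ : C(M, ℝ),
      Tendsto (fun n : ℕ => (n : ℝ)⁻¹ * ∑ j ∈ Finset.range n,
          ∫ x, φ x ∂(Measure.map (iterComp Φ t j) η))
        atTop (𝓝 (∫ y, φ y ∂μ)) := by
  have := hθN.1
  obtain ⟨S, hScount, hSdense⟩ := TopologicalSpace.exists_countable_dense C(M, ℝ)
  have hS : ∀ᵐ t ∂θN, ∀ φ ∈ S, ∀ᵐ x ∂η,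
      Tendsto (fun n : ℕ => (n : ℝ)⁻¹ * ∑ j ∈ Finset.range n, φ (iterComp Φ t j x))
        atTop (𝓝 (∫ y, φ y ∂μ)) := by
    refine (ae_ball_iff hScount).2 fun φ _ => ?_
    refine (Measure.ae_ae_comm ?_).2 ?_
    · exact measurableSet_tendsto _ fun n => (Finset.measurable_fun_sum _ fun j _ =>
        φ.continuous.measurable.comp (measurable_uncurry_iterComp Φ hΦ j)).const_mul _
    · filter_upwards [ae_mem_measureSupport η] with x hx
      filter_upwards [hη hx] with t ht using ht φ
  filter_upwards [hS] with t ht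
  have (j : ℕ) : IsProbabilityMeasure (Measure.map (iterComp Φ t j) η) :=
    Measure.isProbabilityMeasure_map (continuous_iterComp Φ t j).aemeasurable
  exact tendsto_average_integral_of_dense _ μ hSdense fun φ hφ =>
    tendsto_average_integral_map η (continuous_iterComp Φ t) φ (ht φ hφ)
end

section
/- Let (X, 𝒜, m) be a finite measure space, p ≥ 1 an integer, and ι : X → {1,…,p+1}^ℕ a measurable map (with respect to the product σ-algebra), called the itinerary. Suppose there are constants C > 0 and σ₁ > 1 such that for every n ≥ 1 and every word w ∈ {1,…,p+1}^n, m({x ∈ X : ι(x)_j = w_j for all 0 ≤ j < n}) ≤ C·σ₁^{−n}. Then there exist ζ ∈ (0,1), τ ∈ (0,1) and N ∈ ℕ such that for all n ≥ N, m({x ∈ X : #{0 ≤ j < n : ι(x)_j ≤ p} < ζn}) ≤ τ^n. Moreover, for m-almost every x ∈ X there is n(x) such that #{0 ≤ j < n : ι(x)_j ≤ p} ≥ ζn for all n ≥ n(x). -/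
open MeasureTheory Filter

/-- Markov bound for the number of words of length `n` on which a product weight exceeds `a`. -/
theorem card_words_lt_prod_mul_le {α : Type*} [Fintype α] (f : α → ℝ) (hf : ∀ b, 0 ≤ f b)
    (n : ℕ) (a : ℝ) :
    ((Finset.univ.filter fun w : Fin n → α => a < ∏ i, f (w i)).card : ℝ) * a
      ≤ (∑ b, f b) ^ n := by
  rw [Fintype.sum_pow, ← nsmul_eq_mul]
  calc _ ≤ ∑ w ∈ Finset.univ.filter (fun w : Fin n → α => a < ∏ i, f (w i)), ∏ i, f (w i) :=
        Finset.card_nsmul_le_sum _ _ _ fun w hw => (Finset.mem_filter.1 hw).2.le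
    _ ≤ _ := Finset.sum_le_sum_of_subset_of_nonneg (Finset.filter_subset _ _)
        fun w _ _ => Finset.prod_nonneg fun i _ => hf _

/-- If all `n`-cylinders have measure at most `c`, then the points whose itinerary has a product
weight exceeding `a` over the first `n` symbols have measure at most `(∑ b, f b) ^ n / a * c`. -/
theorem measure_lt_prod_itinerary_le {X α : Type*} [MeasurableSpace X] [Fintype α] [Nonempty α]
    (m : Measure X) (ι : X → ℕ → α) (n : ℕ) (c : ℝ) (hc : 0 ≤ c)
    (hcyl : ∀ w : ℕ → α, m {x | ∀ j < n, ι x j = w j} ≤ ENNReal.ofReal c)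
    (f : α → ℝ) (hf : ∀ b, 0 ≤ f b) (a : ℝ) (ha : 0 < a) :
    m {x | a < ∏ j ∈ Finset.range n, f (ι x j)} ≤ ENNReal.ofReal ((∑ b, f b) ^ n / a * c) := by
  classical
  set S := Finset.univ.filter fun w : Fin n → α => a < ∏ i, f (w i) with hS
  have hsub : {x | a < ∏ j ∈ Finset.range n, f (ι x j)} ⊆
      ⋃ w ∈ S, {x | ∀ i : Fin n, ι x i = w i} := by
    intro x hx
    simp only [Set.mem_iUnion]
    refine ⟨fun i => ι x i, ?_, fun i => rfl⟩
    rw [Set.mem_ofPred_eq, Finset.prod_range] at hx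
    simpa [hS] using hx
  have hcyl' : ∀ w : Fin n → α, m {x | ∀ i : Fin n, ι x i = w i} ≤ ENNReal.ofReal c := by
    intro w
    refine le_trans (measure_mono ?_)
      (hcyl fun j => if h : j < n then w ⟨j, h⟩ else Classical.arbitrary α)
    intro x hx j hj
    simpa [hj] using hx ⟨j, hj⟩
  calc _ ≤ ∑ w ∈ S, m {x | ∀ i : Fin n, ι x i = w i} :=
        (measure_mono hsub).trans (measure_biUnion_finset_le _ _)
    _ ≤ S.card • ENNReal.ofReal c := Finset.sum_le_card_nsmul _ _ _ fun w _ => hcyl' w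
    _ = ENNReal.ofReal (S.card * c) := by
        rw [nsmul_eq_mul, ENNReal.ofReal_mul (Nat.cast_nonneg _), ENNReal.ofReal_natCast]
    _ ≤ _ := by
        refine ENNReal.ofReal_le_ofReal (mul_le_mul_of_nonneg_right ?_ hc)
        rw [le_div_iff₀ ha]
        exact card_words_lt_prod_mul_le f hf n a

/-- A weight `t` and a frequency `ζ` for which the exponential counting rate stays below `σ`. -/
theorem exists_weight_frequency_lt (p : ℕ) {σ : ℝ} (hσ : 1 < σ) :
    ∃ t ∈ Set.Ioo (0 : ℝ) 1, ∃ ζ ∈ Set.Ioo (0 : ℝ) 1, (p * t + 1) / t ^ ζ < σ := by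
  have h1 : Tendsto (fun t : ℝ => p * t + 1) (nhdsWithin 0 (Set.Ioi 0)) (nhds 1) := by
    have : ContinuousAt (fun t : ℝ => p * t + 1) 0 := by fun_prop
    simpa [ContinuousAt] using this.tendsto.mono_left nhdsWithin_le_nhds
  obtain ⟨t, ht, ht'⟩ :=
    ((h1.eventually (gt_mem_nhds hσ)).and (Ioo_mem_nhdsGT (zero_lt_one' ℝ))).exists
  have h2 : Tendsto (fun ζ : ℝ => (p * t + 1) / t ^ ζ) (nhdsWithin 0 (Set.Ioi 0))
      (nhds (p * t + 1)) := by
    have : ContinuousAt (fun ζ : ℝ => (p * t + 1) / t ^ ζ) 0 :=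
      continuousAt_const.div (Real.continuousAt_const_rpow ht'.1.ne') (by simp)
    simpa [ContinuousAt] using this.tendsto.mono_left nhdsWithin_le_nhds
  obtain ⟨ζ, hζ, hζ'⟩ :=
    ((h2.eventually (gt_mem_nhds ht)).and (Ioo_mem_nhdsGT (zero_lt_one' ℝ))).exists
  exact ⟨t, ht', ζ, hζ', hζ⟩

/-- A constant multiple of `r ^ n` is eventually below `τ ^ n` for some `τ < 1`. -/
theorem exists_const_mul_pow_le_pow (C : ℝ) {r : ℝ} (hr : 0 ≤ r) (hr1 : r < 1) :
    ∃ τ ∈ Set.Ioo (0 : ℝ) 1, ∃ N : ℕ, ∀ n ≥ N, C * r ^ n ≤ τ ^ n := by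
  obtain ⟨τ, h, hτ1⟩ := exists_between hr1
  have hτ : 0 < τ := hr.trans_lt h
  have hlim : Tendsto (fun n : ℕ => C * (r / τ) ^ n) atTop (nhds 0) := by
    simpa using (tendsto_pow_atTop_nhds_zero_of_lt_one (div_nonneg hr hτ.le)
      ((div_lt_one hτ).2 h)).const_mul C
  obtain ⟨N, hN⟩ := eventually_atTop.1 (hlim.eventually (gt_mem_nhds zero_lt_one))
  refine ⟨τ, ⟨hτ, hτ1⟩, N, fun n hn => ?_⟩
  have := (hN n hn).le
  rwa [div_pow, ← mul_div_assoc, div_le_one (pow_pos hτ n)] at this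

/-- Borel–Cantelli for sets whose measures are eventually bounded by a geometric sequence. -/
theorem ae_eventually_notMem_of_le_pow {X : Type*} [MeasurableSpace X] (m : Measure X)
    (s : ℕ → Set X) {τ : ℝ} (hτ : 0 ≤ τ) (hτ1 : τ < 1) (N : ℕ)
    (h : ∀ n ≥ N, m (s n) ≤ ENNReal.ofReal (τ ^ n)) :
    ∀ᵐ x ∂m, ∀ᶠ n in atTop, x ∉ s n := by
  have hsum : ∑' n, m (s (n + N)) ≠ ⊤ := by
    refine ne_top_of_le_ne_top ?_ (ENNReal.tsum_le_tsum fun n => h (n + N) (Nat.le_add_left N n))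
    exact ((summable_nat_add_iff N).2 (summable_geometric_of_lt_one hτ hτ1)).tsum_ofReal_ne_top
  filter_upwards [ae_eventually_notMem hsum] with x hx
  obtain ⟨k, hk⟩ := eventually_atTop.1 hx
  filter_upwards [eventually_ge_atTop (k + N)] with n hn
  have := hk (n - N) (by omega)
  rwa [Nat.sub_add_cancel (by omega)] at this

/-- **Frequency of visits (abstract Lemma 7.2).** Let `(X, m)` be a finite measure
space, `p ≥ 1`, and `ι : X → {1,…,p+1}^ℕ` a measurable itinerary map, where the
alphabet `{1,…,p+1}` is modelled as `Fin (p+1)` and the symbols `1,…,p` correspond to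
the elements of `Fin (p+1)` with `ℕ`-value `< p`. If every `n`-cylinder has measure at
most `C σ₁^{−n}` (with `C > 0`, `σ₁ > 1`), then there are `ζ, τ ∈ (0,1)` and `N` such
that for all `n ≥ N` the set of points whose itinerary up to time `n` has fewer than
`ζn` entries in `{1,…,p}` has measure at most `τ^n`; moreover for `m`-a.e. `x` the
itinerary eventually has at least `ζn` such entries among the first `n` ones. -/
theorem frequency_of_visits {X : Type*} [MeasurableSpace X]
    (m : Measure X) [IsFiniteMeasure m]
    (p : ℕ) (hp : 1 ≤ p) (ι : X → ℕ → Fin (p + 1)) (hι : Measurable ι)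
    (C : ℝ) (hC : 0 < C) (σ₁ : ℝ) (hσ : 1 < σ₁)
    (hcyl : ∀ n : ℕ, 1 ≤ n → ∀ w : ℕ → Fin (p + 1),
      m {x | ∀ j < n, ι x j = w j} ≤ ENNReal.ofReal (C * σ₁⁻¹ ^ n)) :
    ∃ ζ ∈ Set.Ioo (0 : ℝ) 1, ∃ τ ∈ Set.Ioo (0 : ℝ) 1, ∃ N : ℕ,
      (∀ n ≥ N,
        m {x | ((((Finset.range n).filter fun j => (ι x j : ℕ) < p).card : ℝ) < ζ * n)}
          ≤ ENNReal.ofReal (τ ^ n)) ∧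
      ∀ᵐ x ∂m, ∃ n₀ : ℕ, ∀ n ≥ n₀,
        ζ * n ≤ (((Finset.range n).filter fun j => (ι x j : ℕ) < p).card : ℝ) := by
  obtain ⟨t, ht, ζ, hζ, hlt⟩ := exists_weight_frequency_lt p hσ
  have hσ0 : 0 < σ₁ := by linarith
  have htζ : 0 < t ^ ζ := Real.rpow_pos_of_pos ht.1 ζ
  have hs : 0 < p * t + 1 := by have := ht.1; positivity
  obtain ⟨τ, hτ, N, hN⟩ := exists_const_mul_pow_le_pow C
    (div_nonneg (div_nonneg hs.le htζ.le) hσ0.le) ((div_lt_one hσ0).2 hlt)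
  have hmeas : ∀ n ≥ max N 1,
      m {x | ((((Finset.range n).filter fun j => (ι x j : ℕ) < p).card : ℝ) < ζ * n)}
        ≤ ENNReal.ofReal (τ ^ n) := by
    intro n hn
    let f : Fin (p + 1) → ℝ := fun b => if (b : ℕ) < p then t else 1
    have hf : ∀ b, 0 ≤ f b := fun b => by
      have := ht.1.le
      dsimp only [f]
      split_ifs <;> positivity
    have hfs : ∑ b, f b = p * t + 1 := by simp [f, Fin.sum_univ_castSucc]
    calc _ ≤ m {x | (t ^ ζ) ^ n < ∏ j ∈ Finset.range n, f (ι x j)} := by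
          refine measure_mono fun x hx => ?_
          have hprod : ∏ j ∈ Finset.range n, f (ι x j)
              = t ^ (((Finset.range n).filter fun j => (ι x j : ℕ) < p).card : ℝ) := by
            simp [f, Finset.prod_ite, Real.rpow_natCast]
          rw [Set.mem_ofPred_eq, hprod, ← Real.rpow_mul_natCast ht.1.le]
          exact Real.rpow_lt_rpow_of_exponent_gt ht.1 ht.2 hx
      _ ≤ ENNReal.ofReal ((∑ b, f b) ^ n / (t ^ ζ) ^ n * (C * σ₁⁻¹ ^ n)) :=
          measure_lt_prod_itinerary_le m ι n _ (by positivity)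
            (hcyl n ((le_max_right _ _).trans hn)) f hf _ (pow_pos htζ n)
      _ ≤ _ := by
          refine ENNReal.ofReal_le_ofReal (le_trans (le_of_eq ?_)
            (hN n ((le_max_left _ _).trans hn)))
          rw [hfs, div_pow, div_pow, inv_pow]
          ring
  refine ⟨ζ, hζ, τ, hτ, max N 1, hmeas, ?_⟩
  filter_upwards [ae_eventually_notMem_of_le_pow m _ hτ.1.le hτ.2 _ hmeas] with x hx
  obtain ⟨n₀, hn₀⟩ := eventually_atTop.1 hx
  exact ⟨n₀, fun n hn => not_lt.1 (hn₀ n hn)⟩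
end
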